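/- Let n ≥ 2 and let Ω be a bounded (α, β)-John domain in ℝⁿ. Suppose 1 < p < n. Then there exists a constant c depending only on n, p, α, and β such that inf_{b ∈ ℝ} ( ∫_Ω |u(x) − b|^{p(n−1)/(n−p)} dH^{n−1}_∞ )^{(n−p)/(p(n−1))} ≤ c ( ∫_Ω |∇u(x)|^p dx )^{1/p} for all u ∈ C¹(Ω), where the right-hand side is a Lebesgue integral. -/

import Mathlib

open MeasureTheory Metric Set Bornology
open scoped ENNReal NNReal

/-- The `δ`-dimensional Hausdorff content of a set `E ⊆ ℝⁿ`, defined as the infimum of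
`∑ᵢ rᵢ^δ` over all countable coverings of `E` by open balls `B(xᵢ, rᵢ)`. -/
noncomputable def hContent (n : ℕ) (δ : ℝ) (E : Set (EuclideanSpace ℝ (Fin n))) : ℝ≥0∞ :=
  ⨅ (x : ℕ → EuclideanSpace ℝ (Fin n)) (r : ℕ → ℝ≥0)
    (_ : E ⊆ ⋃ i, Metric.ball (x i) (r i)), ∑' i, (r i : ℝ≥0∞) ^ δ

/-- The `δ`-dimensional Hausdorff measure of `E ⊆ ℝⁿ`, obtained from coverings by open balls of
radii at most `ρ`, in the limit `ρ → 0⁺` (equivalently: the supremum over `ρ > 0`, since the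
infima increase as `ρ` decreases). -/
noncomputable def hMeasure (n : ℕ) (δ : ℝ) (E : Set (EuclideanSpace ℝ (Fin n))) : ℝ≥0∞ :=
  ⨆ (ρ : ℝ≥0) (_ : 0 < ρ),
    ⨅ (x : ℕ → EuclideanSpace ℝ (Fin n)) (r : ℕ → ℝ≥0)
      (_ : E ⊆ ⋃ i, Metric.ball (x i) (r i)) (_ : ∀ i, r i ≤ ρ), ∑' i, (r i : ℝ≥0∞) ^ δ

/-- The Choquet integral `∫_Ω f dH^δ_∞ = ∫₀^∞ H^δ_∞({x ∈ Ω : f x > t}) dt` of a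
(nonnegative) real-valued function with respect to the Hausdorff content. -/
noncomputable def choquet (n : ℕ) (δ : ℝ) (Ω : Set (EuclideanSpace ℝ (Fin n)))
    (f : EuclideanSpace ℝ (Fin n) → ℝ) : ℝ≥0∞ :=
  ∫⁻ t in Set.Ioi (0 : ℝ), hContent n δ {x ∈ Ω | t < f x}

/-- The Choquet integral of an `[0,∞]`-valued function with respect to the Hausdorff content. -/
noncomputable def echoquet (n : ℕ) (δ : ℝ) (Ω : Set (EuclideanSpace ℝ (Fin n)))
    (f : EuclideanSpace ℝ (Fin n) → ℝ≥0∞) : ℝ≥0∞ :=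
  ∫⁻ t in Set.Ioi (0 : ℝ), hContent n δ {x ∈ Ω | ENNReal.ofReal t < f x}

/-- The centered fractional Hardy–Littlewood maximal function
`M_κ f (x) = sup_{r>0} r^{κ-n} ∫_{B(x,r)} |f|`. -/
noncomputable def fracMaximal (n : ℕ) (κ : ℝ) (f : EuclideanSpace ℝ (Fin n) → ℝ)
    (x : EuclideanSpace ℝ (Fin n)) : ℝ≥0∞ :=
  ⨆ (r : ℝ) (_ : 0 < r),
    ENNReal.ofReal (r ^ (κ - n)) * ∫⁻ y in Metric.ball x r, ENNReal.ofReal |f y|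

/-- The Riesz potential of order `1`: `I₁ f (x) = ∫_{ℝⁿ} |f y| / |x-y|^{n-1} dy`. -/
noncomputable def rieszPot (n : ℕ) (f : EuclideanSpace ℝ (Fin n) → ℝ)
    (x : EuclideanSpace ℝ (Fin n)) : ℝ≥0∞ :=
  ∫⁻ y, ENNReal.ofReal |f y| / edist x y ^ ((n : ℝ) - 1)

/-- `Ω` is an `(α, β)`-John domain with John center `x₀`: every `x ∈ Ω` can be joined to `x₀`
by a rectifiable curve `γ : [0, L] → Ω` parametrized by arclength (hence `1`-Lipschitz) with
`γ 0 = x`, `γ L = x₀`, `L ≤ β` and `dist (γ t, ∂Ω) ≥ (α/β) t`. -/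
def IsJohnDomainWithCenter (n : ℕ) (α β : ℝ) (Ω : Set (EuclideanSpace ℝ (Fin n)))
    (x₀ : EuclideanSpace ℝ (Fin n)) : Prop :=
  x₀ ∈ Ω ∧ ∀ x ∈ Ω, ∃ L : ℝ, 0 ≤ L ∧ L ≤ β ∧ ∃ γ : ℝ → EuclideanSpace ℝ (Fin n),
    γ 0 = x ∧ γ L = x₀ ∧ (∀ t ∈ Set.Icc 0 L, γ t ∈ Ω) ∧
    LipschitzOnWith 1 γ (Set.Icc 0 L) ∧
    ∀ t ∈ Set.Icc 0 L, α / β * t ≤ Metric.infDist (γ t) (frontier Ω)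

/-- `Ω` is an `(α, β)`-John domain. -/
def IsJohnDomain (n : ℕ) (α β : ℝ) (Ω : Set (EuclideanSpace ℝ (Fin n))) : Prop :=
  ∃ x₀, IsJohnDomainWithCenter n α β Ω x₀

section Poincare

variable {E : Type*} [NormedAddCommGroup E] [NormedSpace ℝ E]

theorem enorm_sub_le_lintegral_fderiv {Ω : Set E} (hΩ : IsOpen Ω) {u : E → ℝ}
    (hu : ContDiffOn ℝ 1 u Ω) {y z : E} (hseg : ∀ s ∈ Icc (0 : ℝ) 1, z + s • (y - z) ∈ Ω) :
    ‖u y - u z‖ₑ ≤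
      ∫⁻ s in Icc (0 : ℝ) 1, ‖fderiv ℝ u (z + s • (y - z))‖ₑ * ‖y - z‖ₑ := by
  have hline : ∀ s : ℝ, HasDerivAt (fun s : ℝ => z + s • (y - z)) (y - z) s := fun s => by
    simpa using ((hasDerivAt_id s).smul_const (y - z)).const_add z
  have hd : ∀ s ∈ uIcc (0 : ℝ) 1, HasDerivAt (fun s : ℝ => u (z + s • (y - z)))
      (fderiv ℝ u (z + s • (y - z)) (y - z)) s := by
    intro s hs
    rw [uIcc_of_le zero_le_one] at hs
    have hdiff : DifferentiableAt ℝ u (z + s • (y - z)) :=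
      (hu.differentiableOn one_ne_zero).differentiableAt (hΩ.mem_nhds (hseg s hs))
    exact hdiff.hasFDerivAt.comp_hasDerivAt s (hline s)
  have hcont : ContinuousOn (fun s : ℝ => fderiv ℝ u (z + s • (y - z)) (y - z))
      (uIcc (0 : ℝ) 1) := by
    rw [uIcc_of_le zero_le_one]
    refine ContinuousOn.clm_apply ?_ continuousOn_const
    exact (hu.continuousOn_fderiv_of_isOpen hΩ le_rfl).comp
      (by fun_prop) (fun s hs => hseg s hs)
  have hint := intervalIntegral.integral_eq_sub_of_hasDerivAt hd hcont.intervalIntegrable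
  have h1 : u y - u z = ∫ s in Icc (0 : ℝ) 1, fderiv ℝ u (z + s • (y - z)) (y - z) := by
    rw [integral_Icc_eq_integral_Ioc, ← intervalIntegral.integral_of_le zero_le_one, hint]
    simp
  rw [h1]
  exact (enorm_integral_le_lintegral_enorm _).trans
    (lintegral_mono fun s => ContinuousLinearMap.le_opENorm _ _)

variable [FiniteDimensional ℝ E] [MeasurableSpace E] [BorelSpace E]
  (μ : Measure E) [μ.IsAddHaarMeasure]

theorem lintegral_comp_add_smul_sub_le {D : Set E} (hD : Convex ℝ D) (hDm : MeasurableSet D)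
    {F : E → ℝ≥0∞} (hF : Measurable F) {z : E} (hz : z ∈ D) {s : ℝ} (hs : 1 / 2 ≤ s)
    (hs1 : s ≤ 1) :
    ∫⁻ y in D, F (z + s • (y - z)) ∂μ ≤ 2 ^ Module.finrank ℝ E * ∫⁻ y in D, F y ∂μ := by
  have hs0 : 0 < s := by linarith
  set G : E → ℝ≥0∞ := D.indicator F with hG
  have hGm : Measurable G := hF.indicator hDm
  calc ∫⁻ y in D, F (z + s • (y - z)) ∂μ
      = ∫⁻ y in D, G ((z - s • z) + s • y) ∂μ := by
        refine setLIntegral_congr_fun hDm fun y hy => ?_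
        have h1 : (z - s • z) + s • y = z + s • (y - z) := by rw [smul_sub]; abel
        have h2 : z + s • (y - z) ∈ D := hD.add_smul_sub_mem hz hy ⟨hs0.le, hs1⟩
        simp only [h1, hG, indicator_of_mem h2]
    _ ≤ ∫⁻ y, G ((z - s • z) + s • y) ∂μ := setLIntegral_le_lintegral _ _
    _ = ∫⁻ y, G ((z - s • z) + y) ∂(Measure.map (s • ·) μ) :=
        (lintegral_map (hGm.comp (measurable_const_add _)) (measurable_const_smul s)).symm
    _ = ENNReal.ofReal |(s ^ Module.finrank ℝ E)⁻¹| * ∫⁻ y, G y ∂μ := by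
        rw [Measure.map_addHaar_smul μ hs0.ne', lintegral_smul_measure,
          lintegral_add_left_eq_self, smul_eq_mul]
    _ ≤ 2 ^ Module.finrank ℝ E * ∫⁻ y in D, F y ∂μ := by
        rw [hG, lintegral_indicator hDm]
        gcongr
        rw [abs_of_pos (by positivity), ← inv_pow, ENNReal.ofReal_pow (by positivity)]
        gcongr
        rw [← ENNReal.ofReal_ofNat]
        apply ENNReal.ofReal_le_ofReal
        rw [inv_le_comm₀ hs0 two_pos]
        linarith

theorem lintegral_lintegral_enorm_sub_le {Ω : Set E} (hΩ : IsOpen Ω) {u : E → ℝ}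
    (hu : ContDiffOn ℝ 1 u Ω) {D : Set E} (hD : Convex ℝ D) (hDm : MeasurableSet D)
    (hDΩ : D ⊆ Ω) {d : ℝ} (hd : ∀ y ∈ D, ∀ z ∈ D, dist y z ≤ d) :
    ∫⁻ y in D, ∫⁻ z in D, ‖u y - u z‖ₑ ∂μ ∂μ ≤
      ENNReal.ofReal d * 2 ^ Module.finrank ℝ E * μ D * ∫⁻ y in D, ‖fderiv ℝ u y‖ₑ ∂μ := by
  set F : E → ℝ≥0∞ := fun x => ‖fderiv ℝ u x‖ₑ with hFdef
  have hF : Measurable F := (measurable_fderiv ℝ u).enorm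
  have hFs : Measurable fun q : (E × E) × ℝ => F (q.1.2 + q.2 • (q.1.1 - q.1.2)) :=
    hF.comp (by fun_prop)
  have hsec : ∀ s ∈ Icc (0 : ℝ) 1,
      ∫⁻ q, F (q.2 + s • (q.1 - q.2)) ∂((μ.restrict D).prod (μ.restrict D)) ≤
        2 ^ Module.finrank ℝ E * (∫⁻ y in D, F y ∂μ) * μ D := by
    intro s hs
    have hm : Measurable fun q : E × E => F (q.2 + s • (q.1 - q.2)) := hF.comp (by fun_prop)
    rcases le_total (1 / 2) s with h | h
    · rw [lintegral_prod_symm _ hm.aemeasurable]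
      calc _ ≤ ∫⁻ z in D, 2 ^ Module.finrank ℝ E * (∫⁻ y in D, F y ∂μ) ∂μ :=
            setLIntegral_mono' hDm fun z hz =>
              lintegral_comp_add_smul_sub_le μ hD hDm hF hz h hs.2
        _ = _ := by rw [setLIntegral_const]
    · rw [lintegral_prod _ hm.aemeasurable]
      calc _ ≤ ∫⁻ z in D, 2 ^ Module.finrank ℝ E * (∫⁻ y in D, F y ∂μ) ∂μ := by
            refine setLIntegral_mono' hDm fun y hy => ?_
            have := lintegral_comp_add_smul_sub_le μ hD hDm hF hy
              (s := 1 - s) (by linarith) (by linarith [hs.1])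
            refine le_trans (le_of_eq (lintegral_congr fun z => ?_)) this
            congr 1
            simp only [smul_sub, sub_smul, one_smul]
            abel
        _ = _ := by rw [setLIntegral_const]
  calc ∫⁻ y in D, ∫⁻ z in D, ‖u y - u z‖ₑ ∂μ ∂μ
      ≤ ∫⁻ y in D, ∫⁻ z in D,
          (∫⁻ s in Icc (0 : ℝ) 1, F (z + s • (y - z))) * ENNReal.ofReal d ∂μ ∂μ := by
        refine setLIntegral_mono' hDm fun y hy => setLIntegral_mono' hDm fun z hz => ?_
        refine (enorm_sub_le_lintegral_fderiv hΩ hu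
          fun s hs => hDΩ (hD.add_smul_sub_mem hz hy hs)).trans ?_
        have hm : Measurable fun s : ℝ => F (z + s • (y - z)) := hF.comp (by fun_prop)
        rw [lintegral_mul_const _ hm]
        gcongr
        rw [← edist_eq_enorm_sub, edist_dist]
        exact ENNReal.ofReal_le_ofReal (hd y hy z hz)
    _ = (∫⁻ q : E × E, (∫⁻ s in Icc (0 : ℝ) 1, F (q.2 + s • (q.1 - q.2)))
          ∂((μ.restrict D).prod (μ.restrict D))) * ENNReal.ofReal d := by
        have hm : Measurable fun q : E × E => ∫⁻ s in Icc (0 : ℝ) 1, F (q.2 + s • (q.1 - q.2)) :=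
          hFs.lintegral_prod_right'
        rw [← lintegral_mul_const _ hm, lintegral_prod _ (by fun_prop)]
    _ = (∫⁻ s in Icc (0 : ℝ) 1, ∫⁻ q : E × E, F (q.2 + s • (q.1 - q.2))
          ∂((μ.restrict D).prod (μ.restrict D))) * ENNReal.ofReal d := by
        rw [lintegral_lintegral_swap hFs.aemeasurable]
    _ ≤ (∫⁻ _ in Icc (0 : ℝ) 1, 2 ^ Module.finrank ℝ E * (∫⁻ y in D, F y ∂μ) * μ D)
          * ENNReal.ofReal d := by
        gcongr ?_ * _
        exact setLIntegral_mono' measurableSet_Icc hsec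
    _ = _ := by
        rw [setLIntegral_const, Real.volume_Icc, sub_zero, ENNReal.ofReal_one, mul_one]
        ring

end Poincare

theorem enorm_setAverage_sub_le {X : Type*} [MeasurableSpace X] (μ : Measure X)
    {u : X → ℝ} {B B' : Set X} (hB : IntegrableOn u B μ)
    (hB' : IntegrableOn u B' μ) (h0 : μ B ≠ 0) (h0' : μ B' ≠ 0) (ht : μ B ≠ ∞) (ht' : μ B' ≠ ∞) :
    ‖(⨍ y in B, u y ∂μ) - ⨍ z in B', u z ∂μ‖ₑ ≤
      (μ B)⁻¹ * (μ B')⁻¹ * ∫⁻ y in B, ∫⁻ z in B', ‖u y - u z‖ₑ ∂μ ∂μ := by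
  have key : ∀ (A : Set X) (v : X → ℝ), ‖⨍ y in A, v y ∂μ‖ₑ ≤
      (μ A)⁻¹ * ∫⁻ y in A, ‖v y‖ₑ ∂μ := by
    intro A v
    rw [average_eq']
    refine (enorm_integral_le_lintegral_enorm _).trans ?_
    rw [lintegral_smul_measure, Measure.restrict_apply_univ, smul_eq_mul]
  have hsub : ∀ (A : Set X) (v : X → ℝ) (c : ℝ), IntegrableOn v A μ → μ A ≠ 0 → μ A ≠ ∞ →
      ⨍ y in A, (v y - c) ∂μ = (⨍ y in A, v y ∂μ) - c := by
    intro A v c hv hA hA'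
    have : Fact (μ A < ∞) := ⟨hA'.lt_top⟩
    rw [setAverage_eq, setAverage_eq, integral_sub hv (integrable_const c), setIntegral_const,
      smul_sub, smul_smul, inv_mul_cancel₀, one_smul]
    rw [measureReal_def]
    exact (ENNReal.toReal_pos hA hA').ne'
  rw [← hsub B u _ hB h0 ht]
  refine (key _ _).trans ?_
  rw [mul_assoc, ← lintegral_const_mul' _ _ (ENNReal.inv_ne_top.2 h0')]
  gcongr with y
  rw [← enorm_neg, neg_sub, ← hsub B' u _ hB' h0' ht']
  refine (key _ _).trans (le_of_eq ?_)
  congr 1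
  refine lintegral_congr fun z => ?_
  rw [← enorm_neg, neg_sub]

section Chain

variable {E : Type*} [NormedAddCommGroup E] [NormedSpace ℝ E]
  [FiniteDimensional ℝ E] [MeasurableSpace E]
  (μ : Measure E) [μ.IsAddHaarMeasure]

theorem toReal_addHaar_unitBall_pos : 0 < (μ (ball (0 : E) 1)).toReal :=
  ENNReal.toReal_pos (measure_ball_pos μ 0 one_pos).ne' measure_ball_lt_top.ne

variable [BorelSpace E]

theorem addHaar_ball_eq_ofReal (x : E) {r : ℝ} (hr : 0 < r) :
    μ (ball x r) = ENNReal.ofReal (r ^ Module.finrank ℝ E * (μ (ball (0 : E) 1)).toReal) := by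
  rw [Measure.addHaar_ball_of_pos μ x hr, ENNReal.ofReal_mul (by positivity),
    ENNReal.ofReal_toReal measure_ball_lt_top.ne]

theorem edist_setAverage_ball_le {Ω : Set E} (hΩ : IsOpen Ω) {u : E → ℝ}
    (hu : ContDiffOn ℝ 1 u Ω) {c c' : E} {r θ : ℝ} (hr : 0 < r) (hθ : 0 < θ)
    (hcc : dist c c' ≤ (3 / 2 - θ) * r) (hc : ball c (2 * r) ⊆ Ω) :
    edist (⨍ y in ball c r, u y ∂μ) (⨍ y in ball c' (θ * r), u y ∂μ) ≤
      ENNReal.ofReal (3 ^ (Module.finrank ℝ E + 1) /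
          (θ ^ Module.finrank ℝ E * (μ (ball (0 : E) 1)).toReal) *
          (r / r ^ Module.finrank ℝ E)) *
        ∫⁻ y in ball c (3 / 2 * r), ‖fderiv ℝ u y‖ₑ ∂μ := by
  set D := ball c (3 / 2 * r) with hD
  have hBD : ball c r ⊆ D := ball_subset_ball (by linarith)
  have hB'D : ball c' (θ * r) ⊆ D := ball_subset_ball' (by rw [dist_comm]; linarith)
  have hDΩ : closedBall c (3 / 2 * r) ⊆ Ω := (closedBall_subset_ball (by linarith)).trans hc
  have hint : IntegrableOn u D μ :=
    ((hu.continuousOn.mono hDΩ).integrableOn_compact (isCompact_closedBall _ _)).mono_set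
      ball_subset_closedBall
  have hθr : 0 < θ * r := by positivity
  have hw := toReal_addHaar_unitBall_pos (E := E) μ
  rw [edist_eq_enorm_sub]
  refine (enorm_setAverage_sub_le μ (hint.mono_set hBD) (hint.mono_set hB'D)
    (measure_ball_pos μ c hr).ne' (measure_ball_pos μ c' hθr).ne'
    measure_ball_lt_top.ne measure_ball_lt_top.ne).trans ?_
  have hP := lintegral_lintegral_enorm_sub_le μ hΩ hu (convex_ball c (3 / 2 * r))
    measurableSet_ball (ball_subset_closedBall.trans hDΩ) (d := 3 * r) (by
      intro y hy z hz
      rw [mem_ball] at hy hz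
      have := dist_triangle_right y z c
      linarith)
  calc _ ≤ (μ (ball c r))⁻¹ * (μ (ball c' (θ * r)))⁻¹ *
        ∫⁻ y in D, ∫⁻ z in D, ‖u y - u z‖ₑ ∂μ ∂μ := by
        gcongr
    _ ≤ (μ (ball c r))⁻¹ * (μ (ball c' (θ * r)))⁻¹ *
        (ENNReal.ofReal (3 * r) * 2 ^ Module.finrank ℝ E * μ D *
          ∫⁻ y in D, ‖fderiv ℝ u y‖ₑ ∂μ) := by gcongr
    _ = _ := by
        rw [← mul_assoc]
        congr 1
        rw [hD, addHaar_ball_eq_ofReal μ c hr, addHaar_ball_eq_ofReal μ c' hθr,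
          addHaar_ball_eq_ofReal μ c (by positivity : 0 < 3 / 2 * r),
          ← ENNReal.ofReal_inv_of_pos (by positivity), ← ENNReal.ofReal_inv_of_pos (by positivity),
          ← ENNReal.ofReal_ofNat, ← ENNReal.ofReal_pow (by positivity),
          ← ENNReal.ofReal_mul (by positivity), ← ENNReal.ofReal_mul (by positivity),
          ← ENNReal.ofReal_mul (by positivity), ← ENNReal.ofReal_mul (by positivity)]
        congr 1
        have h32 : (3 / 2 * r) ^ Module.finrank ℝ E * 2 ^ Module.finrank ℝ E =
            3 ^ Module.finrank ℝ E * r ^ Module.finrank ℝ E := by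
          rw [← mul_pow, ← mul_pow]; ring
        rw [mul_pow θ r, pow_succ]
        calc _ = (r ^ Module.finrank ℝ E * (μ (ball (0 : E) 1)).toReal)⁻¹ *
              (θ ^ Module.finrank ℝ E * r ^ Module.finrank ℝ E *
                (μ (ball (0 : E) 1)).toReal)⁻¹ *
              (3 * r * ((3 / 2 * r) ^ Module.finrank ℝ E * 2 ^ Module.finrank ℝ E) *
                (μ (ball (0 : E) 1)).toReal) := by ring
          _ = _ := by rw [h32]; field_simp

theorem tendsto_setAverage_ball {Ω : Set E} (hΩ : IsOpen Ω) {u : E → ℝ}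
    (hu : ContinuousOn u Ω) {x : E} (hx : x ∈ Ω) {c : ℕ → E} {r R : ℕ → ℝ}
    (hr : ∀ j, 0 < r j) (hsub : ∀ j, ball (c j) (r j) ⊆ ball x (R j))
    (hR : Filter.Tendsto R Filter.atTop (nhds 0)) :
    Filter.Tendsto (fun j => ⨍ y in ball (c j) (r j), u y ∂μ) Filter.atTop (nhds (u x)) := by
  rw [Metric.tendsto_nhds]
  intro ε hε
  obtain ⟨δ, hδ, hball⟩ := Metric.nhds_basis_closedBall.mem_iff.1
    (Filter.inter_mem (hΩ.mem_nhds hx)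
      ((hu.continuousAt (hΩ.mem_nhds hx)).preimage_mem_nhds
        (closedBall_mem_nhds (u x) (half_pos hε))))
  filter_upwards [hR.eventually_lt_const hδ] with j hj
  have hB : ball (c j) (r j) ⊆ closedBall x δ :=
    (hsub j).trans ((ball_subset_ball hj.le).trans ball_subset_closedBall)
  have hint : IntegrableOn u (ball (c j) (r j)) μ :=
    ((hu.mono fun y hy => (hball hy).1).integrableOn_compact
      (isCompact_closedBall x δ)).mono_set hB
  have := (convex_closedBall (u x) (ε / 2)).set_average_mem isClosed_closedBall
    (measure_ball_pos μ (c j) (hr j)).ne' measure_ball_lt_top.ne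
    ((ae_restrict_iff' measurableSet_ball).2 (Filter.Eventually.of_forall
      fun y hy => (hball (hB hy)).2)) hint
  exact (mem_closedBall.1 this).trans_lt (half_lt_self hε)

theorem edist_setAverage_le_tsum {Ω : Set E} (hΩ : IsOpen Ω) {u : E → ℝ}
    (hu : ContDiffOn ℝ 1 u Ω) {x : E} (hx : x ∈ Ω) {κ T : ℝ} (hκ : 0 < κ) (hκ1 : κ ≤ 1)
    (hT : 0 < T) {c : ℕ → E} (hcx : ∀ j, dist (c j) x ≤ T * (1 - κ / 4) ^ j)
    (hcc : ∀ j, dist (c j) (c (j + 1)) ≤ κ / 4 * (T * (1 - κ / 4) ^ j))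
    (hcΩ : ∀ j, ball (c j) (κ * (T * (1 - κ / 4) ^ j)) ⊆ Ω) :
    edist (⨍ y in ball (c 0) (κ / 2 * T), u y ∂μ) (u x) ≤
      ENNReal.ofReal (3 ^ (Module.finrank ℝ E + 1) /
          ((1 - κ / 4) ^ Module.finrank ℝ E * (μ (ball (0 : E) 1)).toReal) *
          (κ / 4 / (κ / 4) ^ Module.finrank ℝ E)) *
      ∑' j : ℕ, ENNReal.ofReal (2 * T * (1 - κ / 4) ^ j /
          (2 * T * (1 - κ / 4) ^ j) ^ Module.finrank ℝ E) *
        ∫⁻ y in ball x (2 * T * (1 - κ / 4) ^ j),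
          Ω.indicator (fun y => ‖fderiv ℝ u y‖ₑ) y ∂μ := by
  set θ := 1 - κ / 4 with hθ
  have hθ0 : 0 < θ := by linarith
  have hθ1 : θ < 1 := by linarith
  have hw := toReal_addHaar_unitBall_pos (E := E) μ
  set t : ℕ → ℝ := fun j => T * θ ^ j with ht
  have ht0 : ∀ j, 0 < t j := fun j => by positivity
  have htend : Filter.Tendsto (fun j => 2 * t j) Filter.atTop (nhds 0) := by
    simpa using ((tendsto_pow_atTop_nhds_zero_of_lt_one hθ0.le hθ1).const_mul T).const_mul 2
  have hlim := tendsto_setAverage_ball μ hΩ hu.continuousOn hx (c := c)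
    (r := fun j => κ / 2 * t j) (R := fun j => 2 * t j) (fun j => by have := ht0 j; positivity)
    (fun j => ball_subset_ball' (by have := hcx j; have := ht0 j; simp only [ht] at *; nlinarith))
    htend
  rw [← ENNReal.tsum_mul_left]
  have h0 : κ / 2 * T = κ / 2 * t 0 := by simp [ht]
  rw [h0]
  refine edist_le_tsum_of_edist_le_of_tendsto₀ _ (fun j => ?_) hlim
  have htj := ht0 j
  have hstep := edist_setAverage_ball_le μ hΩ hu (c := c j) (c' := c (j + 1))
    (r := κ / 2 * t j) (by positivity) hθ0 (by
      refine (hcc j).trans ?_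
      change κ / 4 * t j ≤ _
      have : (1 : ℝ) / 2 ≤ 3 / 2 - θ := by linarith
      have h2 : 0 < κ / 2 * t j := by positivity
      nlinarith)
    (by refine Subset.trans (le_of_eq ?_) (hcΩ j); congr 1; simp only [ht]; ring)
  have hsucc : θ * (κ / 2 * t j) = κ / 2 * t (j + 1) := by simp only [ht]; ring
  rw [hsucc] at hstep
  refine hstep.trans ?_
  rw [← mul_assoc (ENNReal.ofReal _) (ENNReal.ofReal _), ← ENNReal.ofReal_mul (by positivity)]
  have hsubΩ : ball (c j) (3 / 2 * (κ / 2 * t j)) ⊆ Ω :=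
    (ball_subset_ball (by simp only [ht] at *; nlinarith)).trans (hcΩ j)
  refine mul_le_mul' (ENNReal.ofReal_le_ofReal (le_of_eq ?_)) ?_
  · rw [mul_assoc]
    congr 1
    have : κ / 2 * t j = κ / 4 * (2 * T * θ ^ j) := by simp only [ht]; ring
    rw [this, mul_pow (κ / 4)]
    field_simp
  · calc _ = ∫⁻ y in ball (c j) (3 / 2 * (κ / 2 * t j)),
          Ω.indicator (fun y => ‖fderiv ℝ u y‖ₑ) y ∂μ :=
          setLIntegral_congr_fun measurableSet_ball fun y hy => by
            rw [indicator_of_mem (hsubΩ hy)]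
      _ ≤ _ := lintegral_mono_set (ball_subset_ball' (by
          have := hcx j
          simp only [ht] at *
          nlinarith))

end Chain

section John

theorem ball_infDist_frontier_subset {E : Type*} [NormedAddCommGroup E] [NormedSpace ℝ E]
    [FiniteDimensional ℝ E] {Ω : Set E} (hΩ : Ω ≠ univ) {x : E} (hx : x ∈ Ω) :
    ball x (infDist x (frontier Ω)) ⊆ Ω := by
  obtain ⟨y, hy, hxy⟩ := exists_mem_frontier_infDist_compl_eq_dist hx hΩ
  exact (ball_subset_ball ((infDist_le_dist_of_mem hy).trans hxy.ge)).trans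
    ball_infDist_compl_subset

theorem IsJohnDomain.exists_chain {n : ℕ} (hn : n ≠ 0) {α β : ℝ} (hα : 0 < α) (hβ : 0 < β)
    {Ω : Set (EuclideanSpace ℝ (Fin n))} (hΩ : IsOpen Ω) (hb : IsBounded Ω)
    (hJ : IsJohnDomain n α β Ω) :
    ∃ x₀ : EuclideanSpace ℝ (Fin n), ∃ T : ℝ, 0 < T ∧
      ∀ x ∈ Ω, ∀ θ : ℝ, 0 ≤ θ → θ ≤ 1 → ∃ c : ℕ → EuclideanSpace ℝ (Fin n), c 0 = x₀ ∧
        (∀ j, dist (c j) x ≤ T * θ ^ j) ∧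
        (∀ j, dist (c j) (c (j + 1)) ≤ (1 - θ) * (T * θ ^ j)) ∧
        ∀ j, ball (c j) (α / β * (T * θ ^ j)) ⊆ Ω := by
  obtain ⟨x₀, hx₀, hcurve⟩ := hJ
  have : Nonempty (Fin n) := Fin.pos_iff_nonempty.1 (Nat.pos_of_ne_zero hn)
  have hne : Ω ≠ univ := by
    rintro rfl
    exact NormedSpace.unbounded_univ ℝ (EuclideanSpace ℝ (Fin n)) hb
  have hfr : (frontier Ω).Nonempty := nonempty_frontier_iff.2 ⟨⟨x₀, hx₀⟩, hne⟩
  have hd : 0 < infDist x₀ (frontier Ω) := by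
    refine (isClosed_frontier.notMem_iff_infDist_pos hfr).1 fun h => ?_
    rw [hΩ.frontier_eq] at h
    exact h.2 hx₀
  set κ := α / β with hκ
  have hκ0 : 0 < κ := div_pos hα hβ
  set T := infDist x₀ (frontier Ω) / κ with hT
  have hT0 : 0 < T := div_pos hd hκ0
  have hκT : κ * T = infDist x₀ (frontier Ω) := mul_div_cancel₀ _ hκ0.ne'
  refine ⟨x₀, T, hT0, fun x hx θ hθ hθ1 => ?_⟩
  obtain ⟨L, hL0, -, γ, hγ0, hγL, hγΩ, hγ, hdist⟩ := hcurve x hx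
  have hLT : L ≤ T := by
    have := hdist L ⟨hL0, le_rfl⟩
    rw [hγL, ← hκT] at this
    exact le_of_mul_le_mul_left this hκ0
  have htj : ∀ j : ℕ, 0 ≤ T * θ ^ j := fun j => by positivity
  have hmem : ∀ j : ℕ, min (T * θ ^ j) L ∈ Icc 0 L := fun j =>
    ⟨le_min (htj j) hL0, min_le_right _ _⟩
  have hlip : ∀ s ∈ Icc 0 L, ∀ t ∈ Icc 0 L, dist (γ s) (γ t) ≤ |s - t| := fun s hs t ht => by
    simpa [Real.dist_eq] using hγ.dist_le_mul s hs t ht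
  refine ⟨fun j => γ (min (T * θ ^ j) L), ?_, fun j => ?_, fun j => ?_, fun j => ?_⟩
  · simp [hLT, hγL]
  · have := hlip _ (hmem j) 0 ⟨le_rfl, hL0⟩
    rw [hγ0, sub_zero, abs_of_nonneg (hmem j).1] at this
    exact this.trans (min_le_left _ _)
  · refine (hlip _ (hmem j) _ (hmem (j + 1))).trans ?_
    refine (abs_min_sub_min_le_max _ _ _ _).trans ?_
    have h1 : 0 ≤ (1 - θ) * (T * θ ^ j) := mul_nonneg (by linarith) (htj j)
    have h2 : T * θ ^ j - T * θ ^ (j + 1) = (1 - θ) * (T * θ ^ j) := by ring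
    rw [h2, sub_self, abs_zero, abs_of_nonneg h1, max_eq_left h1]
  · refine Subset.trans (ball_subset_ball ?_) (ball_infDist_frontier_subset hne (hγΩ _ (hmem j)))
    beta_reduce
    rcases le_total (T * θ ^ j) L with h | h
    · rw [min_eq_left h]
      exact hdist _ ⟨htj j, h⟩
    · rw [min_eq_right h, hγL, ← hκT]
      have : θ ^ j ≤ 1 := pow_le_one₀ hθ hθ1
      have : T * θ ^ j ≤ T := mul_le_of_le_one_right hT0.le this
      gcongr

end John

section Content

variable {n : ℕ}

theorem hContent_le_tsum {ι : Type*} [Countable ι] {δ : ℝ} (hδ : 0 < δ)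
    {A : Set (EuclideanSpace ℝ (Fin n))} (x : ι → EuclideanSpace ℝ (Fin n)) (r : ι → ℝ≥0)
    (hA : A ⊆ ⋃ i, ball (x i) (r i)) : hContent n δ A ≤ ∑' i, (r i : ℝ≥0∞) ^ δ := by
  obtain ⟨e, he⟩ := exists_injective_nat ι
  have hcov : A ⊆ ⋃ k, ball (Function.extend e x 0 k) (Function.extend e r 0 k : ℝ≥0) := by
    intro y hy
    obtain ⟨i, hi⟩ := mem_iUnion.1 (hA hy)
    refine mem_iUnion.2 ⟨e i, ?_⟩
    rwa [he.extend_apply, he.extend_apply]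
  have hle : hContent n δ A ≤ ∑' k, ((Function.extend e r 0 k : ℝ≥0) : ℝ≥0∞) ^ δ :=
    iInf₂_le_of_le _ _ (iInf_le _ hcov)
  refine hle.trans (le_of_eq ?_)
  rw [← tsum_extend_zero he]
  refine tsum_congr fun k => ?_
  by_cases hk : ∃ i, e i = k
  · obtain ⟨i, rfl⟩ := hk
    rw [he.extend_apply, he.extend_apply]
  · rw [Function.extend_apply' _ _ _ hk, Function.extend_apply' _ _ _ hk]
    simp [hδ]

theorem hContent_le_of_forall_exists_ball {δ : ℝ} (hδ : 0 < δ)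
    {A : Set (EuclideanSpace ℝ (Fin n))} (ν : Measure (EuclideanSpace ℝ (Fin n))) {K : ℝ≥0∞}
    {R : ℝ} (h : ∀ x ∈ A, ∃ r, 0 < r ∧ r ≤ R ∧ ENNReal.ofReal r ^ δ ≤ K * ν (ball x r)) :
    hContent n δ A ≤ 6 ^ δ * K * ν univ := by
  choose! r hr hrR hν using h
  obtain ⟨v, hvA, hdisj, hcov⟩ := Vitali.exists_disjoint_subfamily_covering_enlargement_closedBall
    A id r R hrR 5 (by norm_num)
  have hcount : v.Countable := hdisj.countable_of_nonempty_interior fun x hx =>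
    ⟨x, ball_subset_interior_closedBall (mem_ball_self (hr x (hvA hx)))⟩
  have := hcount.to_subtype
  have hcov' : A ⊆ ⋃ x : v, ball (x : EuclideanSpace ℝ (Fin n)) (6 * (r x).toNNReal : ℝ≥0) := by
    intro a ha
    obtain ⟨b, hb, hab⟩ := hcov a ha
    have h1 := hab (mem_closedBall_self (hr a ha).le)
    have hrb := hr b (hvA hb)
    refine mem_iUnion.2 ⟨⟨b, hb⟩, closedBall_subset_ball ?_ h1⟩
    simp only [NNReal.coe_mul, NNReal.coe_ofNat, Real.coe_toNNReal _ hrb.le]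
    linarith
  calc hContent n δ A ≤ ∑' x : v, ((6 * (r x).toNNReal : ℝ≥0) : ℝ≥0∞) ^ δ :=
        hContent_le_tsum hδ _ _ hcov'
    _ ≤ ∑' x : v, 6 ^ δ * K * ν (ball (x : EuclideanSpace ℝ (Fin n)) (r x)) := by
        refine ENNReal.tsum_le_tsum fun x => ?_
        rw [ENNReal.coe_mul, ENNReal.mul_rpow_of_nonneg _ _ hδ.le, mul_assoc]
        gcongr
        · norm_num
        · exact hν x (hvA x.2)
    _ = 6 ^ δ * K * ∑' x : v, ν (ball (x : EuclideanSpace ℝ (Fin n)) (r x)) :=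
        ENNReal.tsum_mul_left
    _ ≤ 6 ^ δ * K * ν univ := by
        gcongr
        rw [← measure_iUnion _ fun _ => measurableSet_ball]
        · exact measure_mono (subset_univ _)
        · exact fun x y hxy => (hdisj x.2 y.2 fun h => hxy (Subtype.ext h)).mono
            ball_subset_closedBall ball_subset_closedBall

end Content

theorem setLIntegral_le_rpow_mul_measure {X : Type*} [MeasurableSpace X] (μ : Measure X)
    {F : X → ℝ≥0∞} (hF : Measurable F) {p : ℝ} (hp : 1 < p) (B : Set X) :
    ∫⁻ x in B, F x ∂μ ≤ (∫⁻ x in B, F x ^ p ∂μ) ^ (1 / p) * μ B ^ (1 - 1 / p) := by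
  have hpq := Real.HolderConjugate.conjExponent hp
  have := ENNReal.lintegral_mul_le_Lp_mul_Lq (μ.restrict B) hpq hF.aemeasurable
    (aemeasurable_const (b := (1 : ℝ≥0∞)))
  have h2 : 1 / p.conjExponent = 1 - 1 / p := by
    rw [one_div, one_div, hpq.one_sub_inv]
  simpa [h2] using this

theorem sum_range_succ_le_of_eq_mul {b : ℕ → ℝ} {h : ℝ} (h0 : 0 ≤ h) (h1 : h < 1)
    (hb : ∀ j, 0 ≤ b j) (hrec : ∀ j, b j = h * b (j + 1)) (N : ℕ) :
    ∑ j ∈ Finset.range (N + 1), b j ≤ b N / (1 - h) := by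
  have h1' : 0 < 1 - h := by linarith
  induction N with
  | zero =>
    rw [le_div_iff₀ h1']
    simp only [zero_add, Finset.sum_range_one]
    nlinarith [hb 0]
  | succ N ih =>
    rw [Finset.sum_range_succ]
    refine (add_le_add_left ih _).trans (le_of_eq ?_)
    rw [hrec N]
    field_simp
    ring

section DiscreteRiesz

/-- The discrete Riesz potential `∑ⱼ ρⱼ^{1-n} ∫_{B(x,ρⱼ)} F` over the radii `ρⱼ = ρ θʲ`. -/
noncomputable def discreteRiesz (n : ℕ) (ρ θ : ℝ) (F : EuclideanSpace ℝ (Fin n) → ℝ≥0∞)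
    (x : EuclideanSpace ℝ (Fin n)) : ℝ≥0∞ :=
  ∑' j : ℕ, ENNReal.ofReal (ρ * θ ^ j / (ρ * θ ^ j) ^ n) * ∫⁻ y in ball x (ρ * θ ^ j), F y

/-- The volume of the unit ball of `ℝⁿ`. -/
noncomputable def unitBallVolume (n : ℕ) : ℝ :=
  (volume (ball (0 : EuclideanSpace ℝ (Fin n)) 1)).toReal

variable {n : ℕ}

theorem unitBallVolume_pos : 0 < unitBallVolume n := toReal_addHaar_unitBall_pos volume

theorem volume_ball_eq (x : EuclideanSpace ℝ (Fin n)) {r : ℝ} (hr : 0 < r) :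
    volume (ball x r) = ENNReal.ofReal (r ^ n * unitBallVolume n) := by
  rw [addHaar_ball_eq_ofReal volume x hr, finrank_euclideanSpace_fin, unitBallVolume]

theorem ofReal_mul_setLIntegral_ball_le {F : EuclideanSpace ℝ (Fin n) → ℝ≥0∞}
    (hF : Measurable F) {p : ℝ} (hp : 1 < p) (x : EuclideanSpace ℝ (Fin n)) {r : ℝ}
    (hr : 0 < r) :
    ENNReal.ofReal (r / r ^ n) * ∫⁻ y in ball x r, F y ≤
      ENNReal.ofReal (unitBallVolume n ^ (1 - 1 / p) * r ^ (1 - n / p)) *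
        (∫⁻ y in ball x r, F y ^ p) ^ (1 / p) := by
  have hω := unitBallVolume_pos (n := n)
  have hp' : 0 ≤ 1 - 1 / p := by
    rw [sub_nonneg, div_le_one (by linarith)]; exact hp.le
  calc _ ≤ ENNReal.ofReal (r / r ^ n) *
        ((∫⁻ y in ball x r, F y ^ p) ^ (1 / p) * volume (ball x r) ^ (1 - 1 / p)) := by
        gcongr
        exact setLIntegral_le_rpow_mul_measure volume hF hp _
    _ = ENNReal.ofReal (r / r ^ n * (r ^ n * unitBallVolume n) ^ (1 - 1 / p)) *
        (∫⁻ y in ball x r, F y ^ p) ^ (1 / p) := by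
        rw [volume_ball_eq x hr, ENNReal.ofReal_rpow_of_nonneg (by positivity) hp',
          ENNReal.ofReal_mul (by positivity)]
        ring
    _ = _ := by
        congr 2
        rw [Real.mul_rpow (by positivity) hω.le, ← mul_assoc, mul_comm]
        congr 1
        rw [← Real.rpow_natCast r n, ← Real.rpow_mul hr.le]
        nth_rw 1 [← Real.rpow_one r]
        rw [← Real.rpow_sub hr, ← Real.rpow_add hr]
        congr 1
        ring

/-- Contribution of the radii larger than `R` to the discrete Riesz potential. -/
theorem sum_range_discreteRiesz_le {F : EuclideanSpace ℝ (Fin n) → ℝ≥0∞} (hF : Measurable F)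
    {p : ℝ} (hp : 1 < p) (hpn : p < n) {A : ℝ} (hA : 0 < A)
    (hFA : ∫⁻ y, F y ^ p ≤ ENNReal.ofReal (A ^ p)) {ρ θ R : ℝ} (hρ : 0 < ρ) (hθ : 0 < θ)
    (hθ1 : θ < 1) (hR : 0 < R) (x : EuclideanSpace ℝ (Fin n)) {N : ℕ}
    (hN : ∀ j < N, R ≤ ρ * θ ^ j) :
    ∑ j ∈ Finset.range N, ENNReal.ofReal (ρ * θ ^ j / (ρ * θ ^ j) ^ n) *
        ∫⁻ y in ball x (ρ * θ ^ j), F y ≤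
      ENNReal.ofReal (A * unitBallVolume n ^ (1 - 1 / p) *
        (R ^ (1 - n / p) / (1 - θ ^ (n / p - 1)))) := by
  have hp0 : 0 < p := by linarith
  have hω := unitBallVolume_pos (n := n)
  have hg : 0 < n / p - 1 := by rw [sub_pos, one_lt_div hp0]; exact hpn
  have hh1 : θ ^ ((n : ℝ) / p - 1) < 1 := Real.rpow_lt_one hθ.le hθ1 hg
  have hFA' : (∫⁻ y, F y ^ p) ^ (1 / p) ≤ ENNReal.ofReal A := by
    calc _ ≤ (ENNReal.ofReal (A ^ p)) ^ (1 / p) := by gcongr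
      _ = _ := by
        rw [ENNReal.ofReal_rpow_of_pos (by positivity), ← Real.rpow_mul hA.le,
          mul_one_div_cancel hp0.ne', Real.rpow_one]
  cases N with
  | zero => simp
  | succ N =>
    calc _ ≤ ∑ j ∈ Finset.range (N + 1), ENNReal.ofReal
          (A * unitBallVolume n ^ (1 - 1 / p) * (ρ * θ ^ j) ^ (1 - n / p)) := by
          refine Finset.sum_le_sum fun j _ => ?_
          have hr : 0 < ρ * θ ^ j := by positivity
          refine (ofReal_mul_setLIntegral_ball_le hF hp x hr).trans ?_
          rw [mul_assoc A, mul_comm A, ENNReal.ofReal_mul (q := A) (by positivity)]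
          refine mul_le_mul_right (le_trans ?_ hFA') _
          gcongr
          exact Measure.restrict_le_self
      _ = ENNReal.ofReal (A * unitBallVolume n ^ (1 - 1 / p) *
          ∑ j ∈ Finset.range (N + 1), (ρ * θ ^ j) ^ (1 - n / p)) := by
          rw [Finset.mul_sum, ENNReal.ofReal_sum_of_nonneg fun j _ => by positivity]
      _ ≤ _ := by
          gcongr
          refine (sum_range_succ_le_of_eq_mul (h := θ ^ ((n : ℝ) / p - 1)) (by positivity) hh1
            (fun j => by positivity) (fun j => ?_) N).trans ?_
          · have : ρ * θ ^ (j + 1) = θ * (ρ * θ ^ j) := by ring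
            rw [this, Real.mul_rpow hθ.le (by positivity), ← mul_assoc, ← Real.rpow_add hθ]
            simp
          · have : 0 < 1 - θ ^ ((n : ℝ) / p - 1) := by linarith
            refine div_le_div_of_nonneg_right ?_ this.le
            exact Real.rpow_le_rpow_of_nonpos hR (hN N N.lt_succ_self) (by linarith)

/-- If the truncated discrete Riesz potential of radii below `R` is large, then some ball has
large content-normalised mass. -/
theorem exists_ball_of_lt_tsum {G : EuclideanSpace ℝ (Fin n) → ℝ≥0∞} (hG : Measurable G)
    {s : ℝ} (hs : 1 < s) {τ : ℝ} (hτ : 0 < τ) {ρ θ R : ℝ} (hρ : 0 < ρ) (hθ : 0 < θ)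
    (hθ1 : θ < 1) (hρR : ρ ≤ R) (x : EuclideanSpace ℝ (Fin n))
    (h : ENNReal.ofReal τ < discreteRiesz n ρ θ G x) :
    ∃ r, 0 < r ∧ r ≤ R ∧ ENNReal.ofReal r ^ ((n : ℝ) - 1) ≤
      ENNReal.ofReal (unitBallVolume n ^ (s - 1) * R ^ (s - 1) *
        (τ * (1 - θ ^ (1 - 1 / s))) ^ (-s)) * ∫⁻ y in ball x r, G y ^ s := by
  have hs0 : 0 < s := by linarith
  have hR : 0 < R := hρ.trans_le hρR
  have hω := unitBallVolume_pos (n := n)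
  have hε : 0 < 1 - 1 / s := by
    rw [sub_pos, div_lt_one hs0]; exact hs
  set q := θ ^ (1 - 1 / s) with hq
  have hq0 : 0 < q := by positivity
  have hq1 : q < 1 := Real.rpow_lt_one hθ.le hθ1 hε
  have hgeom : HasSum (fun j : ℕ => τ * (1 - q) * q ^ j) τ := by
    have := (hasSum_geometric_of_lt_one hq0.le hq1).mul_left (τ * (1 - q))
    rwa [mul_assoc τ, mul_inv_cancel₀ (by linarith), mul_one] at this
  have h1q : 0 < 1 - q := by linarith
  obtain ⟨j, hj⟩ : ∃ j : ℕ, ENNReal.ofReal (τ * (1 - q) * q ^ j) <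
      ENNReal.ofReal (ρ * θ ^ j / (ρ * θ ^ j) ^ n) * ∫⁻ y in ball x (ρ * θ ^ j), G y := by
    by_contra! hcon
    refine h.not_ge ((ENNReal.tsum_le_tsum hcon).trans (le_of_eq ?_))
    rw [← ENNReal.ofReal_tsum_of_nonneg (fun j => by positivity) hgeom.summable, hgeom.tsum_eq]
  set r := ρ * θ ^ j with hr
  have hr0 : 0 < r := by positivity
  refine ⟨r, hr0, (mul_le_of_le_one_right hρ.le (pow_le_one₀ hθ.le hθ1.le)).trans hρR, ?_⟩
  have hqj : (r / R) ^ (1 - 1 / s) ≤ q ^ j := by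
    rw [hq, ← Real.rpow_natCast, ← Real.rpow_mul hθ.le, mul_comm (1 - 1 / s),
      Real.rpow_mul hθ.le, Real.rpow_natCast]
    gcongr
    rw [hr, div_le_iff₀ hR, mul_comm]
    gcongr
  have hmain : ENNReal.ofReal (τ * (1 - q) * (r / R) ^ (1 - 1 / s)) ≤
      ENNReal.ofReal (unitBallVolume n ^ (1 - 1 / s) * r ^ (1 - n / s)) *
        (∫⁻ y in ball x r, G y ^ s) ^ (1 / s) := by
    refine le_trans ?_ (hj.le.trans (ofReal_mul_setLIntegral_ball_le hG hs x hr0))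
    gcongr
  have hpow := ENNReal.rpow_le_rpow hmain hs0.le
  have e1 : (1 - 1 / s) * s = s - 1 := by field_simp
  have e2 : (1 - n / s) * s = s - n := by field_simp
  rw [ENNReal.mul_rpow_of_nonneg _ _ hs0.le, ← ENNReal.rpow_mul, one_div_mul_cancel hs0.ne',
    ENNReal.rpow_one, ENNReal.ofReal_rpow_of_pos (by positivity),
    ENNReal.ofReal_rpow_of_pos (by positivity),
    Real.mul_rpow (x := τ * (1 - q)) (by positivity) (by positivity),
    Real.mul_rpow (x := unitBallVolume n ^ _) (by positivity) (by positivity),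
    ← Real.rpow_mul (x := r / R) (by positivity),
    ← Real.rpow_mul hω.le, ← Real.rpow_mul hr0.le, e1, e2] at hpow
  rw [ENNReal.ofReal_rpow_of_pos hr0]
  calc ENNReal.ofReal (r ^ ((n : ℝ) - 1))
      = ENNReal.ofReal ((τ * (1 - q)) ^ (-s) * R ^ (s - 1) * r ^ ((n : ℝ) - s)) *
          ENNReal.ofReal ((τ * (1 - q)) ^ s * (r / R) ^ (s - 1)) := by
        rw [← ENNReal.ofReal_mul (by positivity)]
        congr 1
        rw [Real.div_rpow hr0.le hR.le, Real.rpow_neg (by positivity)]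
        have e3 : r ^ ((n : ℝ) - 1) = r ^ ((n : ℝ) - s) * r ^ (s - 1) := by
          rw [← Real.rpow_add hr0]; congr 1; ring
        rw [e3]
        field_simp
    _ ≤ ENNReal.ofReal ((τ * (1 - q)) ^ (-s) * R ^ (s - 1) * r ^ ((n : ℝ) - s)) *
          (ENNReal.ofReal (unitBallVolume n ^ (s - 1) * r ^ (s - n)) *
            ∫⁻ y in ball x r, G y ^ s) := by gcongr
    _ = _ := by
        rw [← mul_assoc, ← ENNReal.ofReal_mul (by positivity)]
        congr 2
        have e3 : r ^ ((n : ℝ) - s) * r ^ (s - n) = 1 := by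
          rw [← Real.rpow_add hr0]; simp
        linear_combination (τ * (1 - q)) ^ (-s) * R ^ (s - 1) * unitBallVolume n ^ (s - 1) * e3

end DiscreteRiesz

section Level

variable {n : ℕ}

theorem discreteRiesz_eq_sum_add {F : EuclideanSpace ℝ (Fin n) → ℝ≥0∞} (ρ θ : ℝ)
    (x : EuclideanSpace ℝ (Fin n)) (N : ℕ) :
    discreteRiesz n ρ θ F x =
      (∑ j ∈ Finset.range N, ENNReal.ofReal (ρ * θ ^ j / (ρ * θ ^ j) ^ n) *
        ∫⁻ y in ball x (ρ * θ ^ j), F y) + discreteRiesz n (ρ * θ ^ N) θ F x := by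
  have hshift : discreteRiesz n (ρ * θ ^ N) θ F x = ∑' j : ℕ,
      ENNReal.ofReal (ρ * θ ^ (j + N) / (ρ * θ ^ (j + N)) ^ n) *
        ∫⁻ y in ball x (ρ * θ ^ (j + N)), F y := by
    refine tsum_congr fun j => ?_
    rw [show ρ * θ ^ (j + N) = ρ * θ ^ N * θ ^ j by ring]
  rw [hshift]
  exact (ENNReal.summable.sum_add_tsum_nat_add' (f := fun j : ℕ =>
    ENNReal.ofReal (ρ * θ ^ j / (ρ * θ ^ j) ^ n) * ∫⁻ y in ball x (ρ * θ ^ j), F y)).symm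

theorem discreteRiesz_le_add {F G : EuclideanSpace ℝ (Fin n) → ℝ≥0∞} {lam : ℝ} (hlam : 0 ≤ lam)
    (hFG : ∀ y, F y ≤ ENNReal.ofReal lam + G y) {ρ θ : ℝ} (hρ : 0 < ρ) (hθ : 0 < θ)
    (hθ1 : θ < 1) (x : EuclideanSpace ℝ (Fin n)) :
    discreteRiesz n ρ θ F x ≤
      ENNReal.ofReal (lam * unitBallVolume n * ρ / (1 - θ)) + discreteRiesz n ρ θ G x := by
  have hω := unitBallVolume_pos (n := n)
  have hgeom : HasSum (fun j : ℕ => lam * unitBallVolume n * ρ * θ ^ j)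
      (lam * unitBallVolume n * ρ / (1 - θ)) :=
    (hasSum_geometric_of_lt_one hθ.le hθ1).mul_left _
  rw [← hgeom.tsum_eq, ENNReal.ofReal_tsum_of_nonneg (fun j => by positivity) hgeom.summable,
    discreteRiesz, discreteRiesz, ← ENNReal.tsum_add]
  refine ENNReal.tsum_le_tsum fun j => ?_
  have hr : 0 < ρ * θ ^ j := by positivity
  calc _ ≤ ENNReal.ofReal (ρ * θ ^ j / (ρ * θ ^ j) ^ n) *
        ∫⁻ y in ball x (ρ * θ ^ j), (ENNReal.ofReal lam + G y) := by
        gcongr with y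
        exact hFG y
    _ = ENNReal.ofReal (ρ * θ ^ j / (ρ * θ ^ j) ^ n) *
          (ENNReal.ofReal lam * volume (ball x (ρ * θ ^ j))) +
        ENNReal.ofReal (ρ * θ ^ j / (ρ * θ ^ j) ^ n) * ∫⁻ y in ball x (ρ * θ ^ j), G y := by
        rw [lintegral_add_left measurable_const, setLIntegral_const, mul_add]
    _ = _ := by
        congr 1
        rw [volume_ball_eq x hr, ← ENNReal.ofReal_mul hlam, ← ENNReal.ofReal_mul (by positivity)]
        congr 1
        field_simp

theorem hContent_discreteRiesz_le (hn : 1 < n) {F : EuclideanSpace ℝ (Fin n) → ℝ≥0∞}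
    (hF : Measurable F) {p : ℝ} (hp : 1 < p) (hpn : p < n) {A : ℝ} (hA : 0 < A)
    (hFA : ∫⁻ y, F y ^ p ≤ ENNReal.ofReal (A ^ p)) {s : ℝ} (hs : 1 < s) {ρ θ R lam τ : ℝ}
    (hρ : 0 < ρ) (hθ : 0 < θ) (hθ1 : θ < 1) (hR : 0 < R) (hlam : 0 ≤ lam) (hτ : 0 < τ)
    (hfar : A * unitBallVolume n ^ (1 - 1 / p) * (R ^ (1 - n / p) / (1 - θ ^ (n / p - 1))) ≤ τ)
    (hnear : lam * unitBallVolume n * R / (1 - θ) ≤ τ) :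
    hContent n ((n : ℝ) - 1) {x | ENNReal.ofReal (3 * τ) < discreteRiesz n ρ θ F x} ≤
      6 ^ ((n : ℝ) - 1) * ENNReal.ofReal (unitBallVolume n ^ (s - 1) * R ^ (s - 1) *
        (τ * (1 - θ ^ (1 - 1 / s))) ^ (-s)) *
        ∫⁻ y in {y | ENNReal.ofReal lam < F y}, F y ^ s := by
  set S := {y | ENNReal.ofReal lam < F y} with hS
  have hSm : MeasurableSet S := measurableSet_lt measurable_const hF
  set G := S.indicator F with hG
  have hGm : Measurable G := hF.indicator hSm
  have hω := unitBallVolume_pos (n := n)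
  have hn1 : (0 : ℝ) < (n : ℝ) - 1 := by
    rw [sub_pos]; exact_mod_cast hn
  have hFG : ∀ y, F y ≤ ENNReal.ofReal lam + G y := fun y => by
    by_cases hy : y ∈ S
    · rw [hG, indicator_of_mem hy]; exact le_add_self
    · exact (not_lt.1 hy).trans le_self_add
  have hGs : ∫⁻ y in S, F y ^ s = (volume.withDensity fun y => G y ^ s) univ := by
    rw [withDensity_apply _ MeasurableSet.univ, Measure.restrict_univ, ← lintegral_indicator hSm]
    refine lintegral_congr fun y => ?_
    by_cases hy : y ∈ S
    · simp [hG, hy]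
    · simp [hG, hy, (by linarith : 0 < s)]
  rw [hGs]
  refine hContent_le_of_forall_exists_ball (R := R) hn1 _ fun x hx => ?_
  obtain ⟨N, hN, hmin⟩ : ∃ N : ℕ, ρ * θ ^ N < R ∧ ∀ j < N, R ≤ ρ * θ ^ j := by
    have hex : ∃ N : ℕ, ρ * θ ^ N < R := by
      obtain ⟨N, hN⟩ := exists_pow_lt_of_lt_one (div_pos hR hρ) hθ1
      exact ⟨N, by rwa [lt_div_iff₀ hρ, mul_comm] at hN⟩
    classical
    exact ⟨Nat.find hex, Nat.find_spec hex, fun j hj => not_lt.1 (Nat.find_min hex hj)⟩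
  have hρN : 0 < ρ * θ ^ N := by positivity
  have hlt : ENNReal.ofReal τ < discreteRiesz n (ρ * θ ^ N) θ G x := by
    by_contra! hcon
    refine absurd (mem_ofPred.1 hx) (not_lt.2 ?_)
    rw [discreteRiesz_eq_sum_add ρ θ x N]
    have h1 := (sum_range_discreteRiesz_le hF hp hpn hA hFA hρ hθ hθ1 hR x hmin).trans
      (ENNReal.ofReal_le_ofReal hfar)
    have h2 : lam * unitBallVolume n * (ρ * θ ^ N) / (1 - θ) ≤ τ := by
      refine le_trans ?_ hnear
      have : 0 < 1 - θ := by linarith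
      gcongr
    have h3 := (discreteRiesz_le_add hlam hFG hρN hθ hθ1 x).trans
      (add_le_add (ENNReal.ofReal_le_ofReal h2) hcon)
    refine (add_le_add h1 h3).trans (le_of_eq ?_)
    rw [← ENNReal.ofReal_add hτ.le hτ.le, ← ENNReal.ofReal_add hτ.le (by linarith)]
    congr 1
    ring
  obtain ⟨r, hr, hrR, h⟩ := exists_ball_of_lt_tsum hGm hs hτ hρN hθ hθ1 hN.le x hlt
  refine ⟨r, hr, hrR, ?_⟩
  rwa [withDensity_apply _ measurableSet_ball]

end Level

section Integration

variable {n : ℕ}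

theorem hContent_mono {δ : ℝ} {A B : Set (EuclideanSpace ℝ (Fin n))} (h : A ⊆ B) :
    hContent n δ A ≤ hContent n δ B :=
  iInf₂_mono fun _ _ => iInf_mono' fun hB => ⟨h.trans hB, le_rfl⟩

theorem setLIntegral_Ioc_rpow {e T : ℝ} (he : 0 < e) (hT : 0 ≤ T) :
    ∫⁻ t in Ioc 0 T, ENNReal.ofReal (t ^ (e - 1)) = ENNReal.ofReal (T ^ e / e) := by
  have hint : IntervalIntegrable (fun t : ℝ => t ^ (e - 1)) volume 0 T :=
    intervalIntegral.intervalIntegrable_rpow' (by linarith)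
  rw [intervalIntegrable_iff_integrableOn_Ioc_of_le hT] at hint
  rw [← ofReal_integral_eq_lintegral_ofReal hint, ← intervalIntegral.integral_of_le hT,
    integral_rpow (Or.inl (by linarith)), sub_add_cancel, Real.zero_rpow he.ne', sub_zero]
  filter_upwards [self_mem_ae_restrict measurableSet_Ioc] with t ht
  exact Real.rpow_nonneg ht.1.le _

theorem lintegral_Ioi_rpow_mul_superlevel_le {X : Type*} [MeasurableSpace X] (μ : Measure X)
    [SFinite μ] {F : X → ℝ≥0∞} (hF : Measurable F) {c e m s : ℝ} (hc : 0 < c) (he : 0 < e)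
    (hm : 0 < m) (hs : 0 < s) :
    ∫⁻ t in Ioi (0 : ℝ), ENNReal.ofReal (t ^ (e - 1)) *
        ∫⁻ y in {y | ENNReal.ofReal (c * t ^ m) < F y}, F y ^ s ∂μ ≤
      ENNReal.ofReal (c ^ (-(e / m)) / e) * ∫⁻ y, F y ^ (s + e / m) ∂μ := by
  let Φ : ℝ → X → ℝ≥0∞ := fun t y => {z : ℝ × X | ENNReal.ofReal (c * z.1 ^ m) < F z.2}.indicator
    (fun z => ENNReal.ofReal (z.1 ^ (e - 1)) * F z.2 ^ s) (t, y)
  have hlt : MeasurableSet {z : ℝ × X | ENNReal.ofReal (c * z.1 ^ m) < F z.2} :=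
    measurableSet_lt (by fun_prop) (hF.comp measurable_snd)
  have hΦ : Measurable (Function.uncurry Φ) := by
    refine Measurable.indicator ?_ hlt
    exact Measurable.mul (by fun_prop) ((hF.comp measurable_snd).pow_const s)
  have hleft : ∀ t : ℝ, ENNReal.ofReal (t ^ (e - 1)) *
      ∫⁻ y in {y | ENNReal.ofReal (c * t ^ m) < F y}, F y ^ s ∂μ = ∫⁻ y, Φ t y ∂μ := fun t => by
    rw [← lintegral_const_mul _ (hF.pow_const s),
      ← lintegral_indicator (measurableSet_lt measurable_const hF)]
    rfl
  simp_rw [hleft]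
  rw [lintegral_lintegral_swap hΦ.aemeasurable, ← lintegral_const_mul _ (hF.pow_const _)]
  refine lintegral_mono fun y => ?_
  have hK : 0 < c ^ (-(e / m)) / e := by positivity
  rcases eq_or_ne (F y) ∞ with hy | hy
  · rw [hy, ENNReal.top_rpow_of_pos (by positivity), ENNReal.mul_top]
    · exact le_top
    · simpa using hK
  rcases eq_or_ne (F y) 0 with hy0 | hy0
  · have : ∀ t, Φ t y = 0 := fun t => indicator_of_notMem (by simp [hy0]) _
    simp [this]
  obtain ⟨v, hv, hFv⟩ : ∃ v : ℝ, 0 < v ∧ F y = ENNReal.ofReal v :=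
    ⟨(F y).toReal, ENNReal.toReal_pos hy0 hy, (ENNReal.ofReal_toReal hy).symm⟩
  set T := (v / c) ^ (1 / m) with hT
  calc ∫⁻ t in Ioi (0 : ℝ), Φ t y
      ≤ ∫⁻ t in Ioi (0 : ℝ), (Ioc 0 T).indicator
          (fun t => ENNReal.ofReal (v ^ s) * ENNReal.ofReal (t ^ (e - 1))) t := by
        refine setLIntegral_mono' measurableSet_Ioi fun t ht => ?_
        by_cases h : ENNReal.ofReal (c * t ^ m) < F y
        · have hΦt : Φ t y = ENNReal.ofReal (t ^ (e - 1)) * F y ^ s :=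
            indicator_of_mem (s := {z : ℝ × X | ENNReal.ofReal (c * z.1 ^ m) < F z.2}) h _
          rw [hΦt, indicator_of_mem, hFv, ENNReal.ofReal_rpow_of_pos hv, mul_comm]
          refine ⟨ht, ?_⟩
          rw [hFv, ENNReal.ofReal_lt_ofReal_iff hv, mul_comm, ← lt_div_iff₀ hc] at h
          rw [hT, one_div]
          exact (Real.le_rpow_inv_iff_of_pos (le_of_lt ht) (by positivity) hm).2 h.le
        · have hΦt : Φ t y = 0 :=
            indicator_of_notMem (s := {z : ℝ × X | ENNReal.ofReal (c * z.1 ^ m) < F z.2}) h _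
          rw [hΦt]
          exact zero_le
    _ ≤ ∫⁻ t, (Ioc 0 T).indicator
          (fun t => ENNReal.ofReal (v ^ s) * ENNReal.ofReal (t ^ (e - 1))) t :=
        setLIntegral_le_lintegral _ _
    _ = ENNReal.ofReal (v ^ s) * ENNReal.ofReal (T ^ e / e) := by
        rw [lintegral_indicator measurableSet_Ioc, lintegral_const_mul _ (by fun_prop),
          setLIntegral_Ioc_rpow he (by positivity)]
    _ = _ := by
        rw [hFv, ENNReal.ofReal_rpow_of_pos hv, ← ENNReal.ofReal_mul (by positivity),
          ← ENNReal.ofReal_mul (by positivity)]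
        congr 1
        rw [hT, ← Real.rpow_mul (by positivity), Real.div_rpow hv.le hc.le, Real.rpow_add hv,
          Real.rpow_neg hc.le, one_div_mul_eq_div]
        field_simp

theorem exists_forall_hContent_discreteRiesz_le (hn : 1 < n) {p s θ : ℝ} (hp : 1 < p)
    (hpn : p < n) (hs : 1 < s) (hθ : 0 < θ) (hθ1 : θ < 1) :
    ∃ K L : ℝ, 0 < K ∧ 0 < L ∧ ∀ F : EuclideanSpace ℝ (Fin n) → ℝ≥0∞, Measurable F →
      ∀ A : ℝ, 0 < A → ∫⁻ y, F y ^ p ≤ ENNReal.ofReal (A ^ p) → ∀ ρ : ℝ, 0 < ρ → ∀ τ : ℝ, 0 < τ →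
        hContent n ((n : ℝ) - 1) {x | ENNReal.ofReal (3 * τ) < discreteRiesz n ρ θ F x} ≤
          ENNReal.ofReal (K * A ^ (p / (n - p) * (s - 1)) * τ ^ (-(p / (n - p) * (s - 1)) - s)) *
            ∫⁻ y in {y | ENNReal.ofReal (L * A ^ (-(p / (n - p))) * τ ^ (1 + p / (n - p))) < F y},
              F y ^ s := by
  have hω := unitBallVolume_pos (n := n)
  have hp0 : 0 < p := by linarith
  have hnp : 0 < n - p := by linarith
  have hs0 : 0 < s := by linarith
  have hn1 : (0 : ℝ) < (n : ℝ) - 1 := by linarith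
  set a := p / (n - p) with ha
  have h1 : 0 < 1 - θ ^ (n / p - 1) := by
    rw [sub_pos]
    exact Real.rpow_lt_one hθ.le hθ1 (by rw [sub_pos, one_lt_div hp0]; exact hpn)
  have h2 : 0 < 1 - θ ^ (1 - 1 / s) := by
    rw [sub_pos]
    exact Real.rpow_lt_one hθ.le hθ1 (by rw [sub_pos, div_lt_one hs0]; exact hs)
  have h3 : 0 < 1 - θ := by linarith
  set D := unitBallVolume n ^ (1 - 1 / p) / (1 - θ ^ (n / p - 1)) with hD
  have hD0 : 0 < D := by positivity
  refine ⟨6 ^ ((n : ℝ) - 1) * (unitBallVolume n ^ (s - 1) * D ^ (a * (s - 1)) *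
    (1 - θ ^ (1 - 1 / s)) ^ (-s)), (1 - θ) / unitBallVolume n * D ^ (-a), by positivity,
    by positivity, fun F hF A hA hFA ρ hρ τ hτ => ?_⟩
  set R := (D * A / τ) ^ a with hR
  have hR0 : 0 < R := by positivity
  have hRτ : ∀ k, R ^ k = D ^ (a * k) * A ^ (a * k) * τ ^ (-(a * k)) := fun k => by
    rw [hR, ← Real.rpow_mul (by positivity), Real.div_rpow (by positivity) hτ.le,
      Real.mul_rpow hD0.le hA.le, Real.rpow_neg hτ.le, div_eq_mul_inv]
  have hlam : (1 - θ) / unitBallVolume n * D ^ (-a) * A ^ (-a) * τ ^ (1 + a) =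
      (1 - θ) * τ / (unitBallVolume n * R) := by
    have : τ ^ (1 + a) = τ * τ ^ a := by rw [Real.rpow_add hτ, Real.rpow_one]
    rw [this, hR, Real.div_rpow (by positivity) hτ.le, Real.mul_rpow hD0.le hA.le,
      Real.rpow_neg hD0.le, Real.rpow_neg hA.le]
    field_simp
  rw [hlam]
  refine (hContent_discreteRiesz_le hn hF hp hpn hA hFA hs hρ hθ hθ1 hR0
    (lam := (1 - θ) * τ / (unitBallVolume n * R)) (by positivity) hτ (le_of_eq ?_)
    (le_of_eq ?_)).trans (le_of_eq ?_)
  · have hexp : a * (1 - n / p) = -1 := by rw [ha]; field_simp; ring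
    rw [hR, ← Real.rpow_mul (by positivity), hexp, Real.rpow_neg_one, hD]
    generalize 1 - θ ^ (n / p - 1) = H at h1
    field_simp
  · field_simp
  · have h6 : (6 : ℝ≥0∞) ^ ((n : ℝ) - 1) = ENNReal.ofReal (6 ^ ((n : ℝ) - 1)) := by
      rw [← ENNReal.ofReal_rpow_of_pos (by norm_num)]
      norm_num
    rw [h6, ← ENNReal.ofReal_mul (by positivity)]
    congr 2
    rw [hRτ, Real.mul_rpow hτ.le h2.le, sub_eq_add_neg (-(a * (s - 1))) s, Real.rpow_add hτ]
    ring

theorem exists_forall_choquet_le (hn : 1 < n) {p θ M : ℝ} (hp : 1 < p) (hpn : p < n)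
    (hθ : 0 < θ) (hθ1 : θ < 1) (hM : 0 < M) :
    ∃ K : ℝ, 0 < K ∧ ∀ F : EuclideanSpace ℝ (Fin n) → ℝ≥0∞, Measurable F →
      ∀ A : ℝ, 0 < A → ∫⁻ y, F y ^ p ≤ ENNReal.ofReal (A ^ p) → ∀ ρ : ℝ, 0 < ρ →
      ∀ (Ω : Set (EuclideanSpace ℝ (Fin n))) (g : EuclideanSpace ℝ (Fin n) → ℝ),
        (∀ x ∈ Ω, ENNReal.ofReal |g x| ≤ ENNReal.ofReal M * discreteRiesz n ρ θ F x) →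
        choquet n ((n : ℝ) - 1) Ω (fun x => |g x| ^ (p * ((n : ℝ) - 1) / (n - p))) ≤
          ENNReal.ofReal (K * A ^ (p * ((n : ℝ) - 1) / (n - p))) := by
  have hp0 : 0 < p := by linarith
  have hnp : 0 < n - p := by linarith
  have hn1 : (0 : ℝ) < (n : ℝ) - 1 := by linarith
  have hn0 : (0 : ℝ) < n := by linarith
  obtain ⟨s, hs, hsp⟩ := exists_between hp
  have hs0 : 0 < s := by linarith
  obtain ⟨K, L, hK, hL, h⟩ := exists_forall_hContent_discreteRiesz_le hn hp hpn hs hθ hθ1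
  set a := p / (n - p) with ha
  set q := p * ((n : ℝ) - 1) / (n - p) with hq
  have hq0 : 0 < q := by positivity
  have ha0 : 0 < a := by positivity
  have hps : 0 < p - s := by linarith
  set m := (1 + a) / q with hm
  have hm0 : 0 < m := by positivity
  set e := (p - s) * m with he
  have he0 : 0 < e := by positivity
  have hexp : 1 / q * (-(a * (s - 1)) - s) = e - 1 := by
    rw [he, hm, ha, hq]
    field_simp
    ring
  have hem : s + e / m = p := by rw [he]; field_simp; ring
  have hem' : e / m = p - s := by linarith
  set B := (3 * M)⁻¹ with hB
  have hB0 : 0 < B := by positivity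
  refine ⟨K * B ^ (-(a * (s - 1)) - s) * ((L * B ^ (1 + a)) ^ (-(e / m)) / e), by positivity,
    fun F hF A hA hFA ρ hρ Ω g hg => ?_⟩
  have hlevel : ∀ t ∈ Ioi (0 : ℝ), hContent n ((n : ℝ) - 1) {x ∈ Ω | t < |g x| ^ q} ≤
      ENNReal.ofReal (K * B ^ (-(a * (s - 1)) - s) * A ^ (a * (s - 1))) *
        (ENNReal.ofReal (t ^ (e - 1)) *
          ∫⁻ y in {y | ENNReal.ofReal (L * B ^ (1 + a) * A ^ (-a) * t ^ m) < F y}, F y ^ s) := by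
    intro t ht
    have ht0 : 0 < t := ht
    have hτ : 0 < B * t ^ (1 / q) := by positivity
    have hsub : {x ∈ Ω | t < |g x| ^ q} ⊆
        {x | ENNReal.ofReal (3 * (B * t ^ (1 / q))) < discreteRiesz n ρ θ F x} := by
      rintro x ⟨hx, htx⟩
      have h1 : t ^ (1 / q) < |g x| := by
        rw [one_div]
        exact (Real.rpow_inv_lt_iff_of_pos ht0.le (abs_nonneg _) hq0).2 htx
      have h2 : ENNReal.ofReal M * ENNReal.ofReal (3 * (B * t ^ (1 / q))) <
          ENNReal.ofReal M * discreteRiesz n ρ θ F x := by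
        refine lt_of_lt_of_le ?_ (hg x hx)
        rw [← ENNReal.ofReal_mul hM.le,
          ENNReal.ofReal_lt_ofReal_iff ((Real.rpow_pos_of_pos ht0 _).trans h1)]
        refine lt_of_eq_of_lt ?_ h1
        rw [hB]
        field_simp
      exact lt_of_mul_lt_mul_left' h2
    refine (hContent_mono hsub).trans ((h F hF A hA hFA ρ hρ _ hτ).trans (le_of_eq ?_))
    rw [← mul_assoc, ← ENNReal.ofReal_mul (by positivity), Real.mul_rpow hB0.le (by positivity),
      Real.mul_rpow hB0.le (by positivity), ← Real.rpow_mul ht0.le, ← Real.rpow_mul ht0.le, hexp,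
      one_div_mul_eq_div, ← hm]
    congr 2
    · ring
    · congr 1
      ext y
      simp only [mem_ofPred_eq]
      rw [show L * A ^ (-a) * (B ^ (1 + a) * t ^ m) = L * B ^ (1 + a) * A ^ (-a) * t ^ m by ring]
  calc choquet n ((n : ℝ) - 1) Ω (fun x => |g x| ^ q)
      ≤ ∫⁻ t in Ioi (0 : ℝ), ENNReal.ofReal (K * B ^ (-(a * (s - 1)) - s) * A ^ (a * (s - 1))) *
        (ENNReal.ofReal (t ^ (e - 1)) *
          ∫⁻ y in {y | ENNReal.ofReal (L * B ^ (1 + a) * A ^ (-a) * t ^ m) < F y}, F y ^ s) :=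
        setLIntegral_mono' measurableSet_Ioi hlevel
    _ = ENNReal.ofReal (K * B ^ (-(a * (s - 1)) - s) * A ^ (a * (s - 1))) *
        ∫⁻ t in Ioi (0 : ℝ), ENNReal.ofReal (t ^ (e - 1)) *
          ∫⁻ y in {y | ENNReal.ofReal (L * B ^ (1 + a) * A ^ (-a) * t ^ m) < F y}, F y ^ s :=
        lintegral_const_mul' _ _ ENNReal.ofReal_ne_top
    _ ≤ ENNReal.ofReal (K * B ^ (-(a * (s - 1)) - s) * A ^ (a * (s - 1))) *
        (ENNReal.ofReal ((L * B ^ (1 + a) * A ^ (-a)) ^ (-(e / m)) / e) *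
          ENNReal.ofReal (A ^ p)) := by
        gcongr
        refine (lintegral_Ioi_rpow_mul_superlevel_le volume hF (by positivity) he0 hm0 hs0).trans ?_
        rw [hem]
        gcongr
    _ = _ := by
        rw [← ENNReal.ofReal_mul (by positivity), ← ENNReal.ofReal_mul (by positivity)]
        congr 1
        have hAq : A ^ (a * (s - 1)) * (A ^ (a * (e / m)) * A ^ p) = A ^ q := by
          rw [← Real.rpow_add hA, ← Real.rpow_add hA, hem', ha, hq]
          congr 1
          field_simp
          ring
        rw [Real.mul_rpow (x := L * B ^ (1 + a)) (by positivity) (by positivity),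
          ← Real.rpow_mul hA.le, neg_mul_neg, ← hAq]
        ring

end Integration

/-- Corollary: Poincaré–Sobolev inequality with the `(n-1)`-dimensional
Hausdorff content on the left and the Lebesgue integral on the right. For a bounded
`(α,β)`-John domain `Ω ⊆ ℝⁿ` and `1 < p < n` there is `c = c(n, p, α, β)` such that
`inf_b (∫_Ω |u-b|^{p(n-1)/(n-p)} dH^{n-1}_∞)^{(n-p)/(p(n-1))} ≤ c (∫_Ω |∇u|^p dx)^{1/p}`
for all `u ∈ C¹(Ω)`. -/
theorem poincare_sobolev_content_lebesgue (n : ℕ) (hn : 2 ≤ n) (α β p : ℝ)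
    (hα : 0 < α) (hαβ : α ≤ β) (hp1 : 1 < p) (hp2 : p < n) :
    ∃ c : ℝ≥0, 0 < c ∧
      ∀ Ω : Set (EuclideanSpace ℝ (Fin n)), IsOpen Ω → IsConnected Ω → IsBounded Ω →
        IsJohnDomain n α β Ω →
        ∀ u : EuclideanSpace ℝ (Fin n) → ℝ, ContDiffOn ℝ 1 u Ω →
          ⨅ b : ℝ,
              (choquet n ((n : ℝ) - 1) Ω fun x =>
                  |u x - b| ^ (p * ((n : ℝ) - 1) / (n - p))) ^ (((n : ℝ) - p) / (p * (n - 1)))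
            ≤ c * (∫⁻ x in Ω, ENNReal.ofReal (‖fderiv ℝ u x‖ ^ p)) ^ (1 / p) := by
  have hβ : 0 < β := hα.trans_le hαβ
  have hn' : 1 < n := hn
  have hp0 : 0 < p := by linarith
  have hnp : 0 < n - p := by linarith
  have hn1 : (0 : ℝ) < (n : ℝ) - 1 := by linarith
  set κ := α / β with hκ
  have hκ0 : 0 < κ := by positivity
  have hκ1 : κ ≤ 1 := (div_le_one hβ).2 hαβ
  have hθ0 : 0 < 1 - κ / 4 := by linarith
  have hθ1 : 1 - κ / 4 < 1 := by linarith
  have hω := unitBallVolume_pos (n := n)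
  set M := 3 ^ (n + 1) / ((1 - κ / 4) ^ n * unitBallVolume n) * (κ / 4 / (κ / 4) ^ n) with hM
  have hM0 : 0 < M := by positivity
  obtain ⟨K, hK, hchoquet⟩ := exists_forall_choquet_le hn' hp1 hp2 hθ0 hθ1 hM0
  set q := p * ((n : ℝ) - 1) / (n - p) with hq
  have hq0 : 0 < q := by positivity
  have hq1 : ((n : ℝ) - p) / (p * (n - 1)) = 1 / q := by rw [hq, one_div_div]
  have hc0 : 0 < K ^ (1 / q) := by positivity
  refine ⟨(K ^ (1 / q)).toNNReal, Real.toNNReal_pos.2 hc0, fun Ω hΩ _ hb hJ u hu => ?_⟩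
  obtain ⟨x₀, T, hT, hchain⟩ := hJ.exists_chain (by omega) hα hβ hΩ hb
  set W := ∫⁻ x in Ω, ENNReal.ofReal (‖fderiv ℝ u x‖ ^ p) with hW
  set F := Ω.indicator fun y => ‖fderiv ℝ u y‖ₑ with hF
  have hFm : Measurable F := (measurable_fderiv ℝ u).enorm.indicator hΩ.measurableSet
  have hFW : ∫⁻ y, F y ^ p = W := by
    rw [hW, ← lintegral_indicator hΩ.measurableSet]
    refine lintegral_congr fun y => ?_
    by_cases hy : y ∈ Ω
    · rw [hF, indicator_of_mem hy, indicator_of_mem hy, ← ofReal_norm,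
        ENNReal.ofReal_rpow_of_nonneg (norm_nonneg _) hp0.le]
    · rw [hF, indicator_of_notMem hy, indicator_of_notMem hy, ENNReal.zero_rpow_of_pos hp0]
  set b := ⨍ y in ball x₀ (κ / 2 * T), u y
  have hpoint : ∀ x ∈ Ω, ENNReal.ofReal |u x - b| ≤
      ENNReal.ofReal M * discreteRiesz n (2 * T) (1 - κ / 4) F x := fun x hx => by
    obtain ⟨c, rfl, hcx, hcc, hcΩ⟩ := hchain x hx (1 - κ / 4) hθ0.le hθ1.le
    rw [sub_sub_cancel] at hcc
    have := edist_setAverage_le_tsum volume hΩ hu hx hκ0 hκ1 hT hcx hcc hcΩ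
    rwa [finrank_euclideanSpace_fin, edist_comm, edist_dist, Real.dist_eq] at this
  refine (iInf_le _ b).trans ?_
  rw [hq1]
  refine ENNReal.le_of_forall_pos_le_add fun ε hε hfin => ?_
  have hw : W ^ (1 / p) ≠ ∞ := fun h => hfin.ne <| by
    rw [h, ENNReal.mul_top]
    simpa using hc0
  set w := (W ^ (1 / p)).toReal with hw'
  have hW' : W ^ (1 / p) = ENNReal.ofReal w := (ENNReal.ofReal_toReal hw).symm
  have hw0 : 0 ≤ w := ENNReal.toReal_nonneg
  have hε' : (0 : ℝ) < ε := hε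
  have hA : 0 < w + ε / K ^ (1 / q) := by positivity
  have hWA : W ≤ ENNReal.ofReal ((w + ε / K ^ (1 / q)) ^ p) := by
    rw [← ENNReal.ofReal_rpow_of_pos hA]
    calc W = (W ^ (1 / p)) ^ p := by
          rw [← ENNReal.rpow_mul, one_div_mul_cancel hp0.ne', ENNReal.rpow_one]
      _ ≤ _ := by
          rw [hW']
          gcongr
          exact le_add_of_nonneg_right (by positivity)
  refine (ENNReal.rpow_le_rpow (hchoquet F hFm _ hA (hFW.trans_le hWA) (2 * T) (by positivity) Ω
    (fun x => u x - b) hpoint) (by positivity)).trans (le_of_eq ?_)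
  rw [hW', ENNReal.ofReal_rpow_of_pos (by positivity), Real.mul_rpow hK.le (by positivity),
    ← Real.rpow_mul hA.le, mul_one_div_cancel hq0.ne', Real.rpow_one, ← ENNReal.ofReal,
    ← ENNReal.ofReal_coe_nnreal, ← ENNReal.ofReal_mul hc0.le,
    ← ENNReal.ofReal_add (by positivity) hε'.le]
  congr 1
  field_simp
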